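/- Let s be a Schur function with log(1 − |s|²) ∈ L¹(γ) for an arc γ ⊂ 𝕋, and let σ_γ be the outer Schur function with |σ_γ|² = 1 − |s|² a.e. on γ and |σ_γ| = 1 a.e. on 𝕋 \ γ. Then s admits a pseudocontinuation of bounded type across γ if and only if σ_γ does. -/

import Mathlib

open MeasureTheory Filter Complex Set Matrix

noncomputable section

/-- The open unit disk. -/
def unitDisk : Set ℂ := {z : ℂ | ‖z‖ < 1}

/-- The exterior of the closed unit disk. -/
def extDisk : Set ℂ := {z : ℂ | 1 < ‖z‖}

/-- Point on the unit circle with angle `θ`. -/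
def circlePt (θ : ℝ) : ℂ := Complex.exp (θ * Complex.I)

/-- One full period of angles, parametrizing the circle 𝕋. -/
def circleSet : Set ℝ := Set.Ioc 0 (2 * Real.pi)

/-- `RadLim f θ w` : the radial (nontangential) boundary value of `f` (analytic in the
disk) at the boundary point `circlePt θ` exists and equals `w`. -/
def RadLim (f : ℂ → ℂ) (θ : ℝ) (w : ℂ) : Prop :=
  Filter.Tendsto (fun r : ℝ => f ((r : ℂ) * circlePt θ))
    (nhdsWithin 1 (Set.Iio 1)) (nhds w)

/-- `RadLimExt f θ w` : the radial boundary value of `f` (analytic in the exterior disk)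
at the boundary point `circlePt θ`, taken from outside. -/
def RadLimExt (f : ℂ → ℂ) (θ : ℝ) (w : ℂ) : Prop :=
  Filter.Tendsto (fun r : ℝ => f ((r : ℂ) * circlePt θ))
    (nhdsWithin 1 (Set.Ioi 1)) (nhds w)

/-- A Schur function: analytic on the unit disk and bounded by 1 in modulus. -/
def SchurFn (f : ℂ → ℂ) : Prop :=
  DifferentiableOn ℂ f unitDisk ∧ ∀ z ∈ unitDisk, ‖f z‖ ≤ 1

/-- The Nevanlinna class on a domain `Ω` : quotients of two bounded (contractive)
analytic functions, with not-identically-zero denominator. -/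
def NevOn (Ω : Set ℂ) (f : ℂ → ℂ) : Prop :=
  ∃ f₁ f₂ : ℂ → ℂ, DifferentiableOn ℂ f₁ Ω ∧ DifferentiableOn ℂ f₂ Ω ∧
    (∀ z ∈ Ω, ‖f₁ z‖ ≤ 1) ∧ (∀ z ∈ Ω, ‖f₂ z‖ ≤ 1) ∧
    (∃ z ∈ Ω, f₂ z ≠ 0) ∧ (∀ z ∈ Ω, f₂ z ≠ 0 → f z = f₁ z / f₂ z)

/-- An arc of the unit circle, described by its set of angles (one full period is
`Set.Ioo 0 (2π)` up to a null set, so the case γ = 𝕋 is not excluded). -/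
def IsArc (γ : Set ℝ) : Prop :=
  ∃ a b : ℝ, 0 ≤ a ∧ a < b ∧ b ≤ 2 * Real.pi ∧ γ = Set.Ioo a b

/-- `f` admits a pseudocontinuation of bounded type across the arc with angle set `γ` :
there is a Nevanlinna function on the exterior disk whose boundary values agree with
those of `f` a.e. on `γ`. -/
def PCArc (f : ℂ → ℂ) (γ : Set ℝ) : Prop :=
  ∃ ft : ℂ → ℂ, NevOn extDisk ft ∧
    ∀ᵐ θ ∂(volume.restrict γ), ∃ w : ℂ, RadLim f θ w ∧ RadLimExt ft θ w

/-- The boundary values of `f` exist and are unimodular a.e. on `γ`. -/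
def UnimodularAEOn (f : ℂ → ℂ) (γ : Set ℝ) : Prop :=
  ∀ᵐ θ ∂(volume.restrict γ), ∃ w : ℂ, RadLim f θ w ∧ ‖w‖ = 1

/-- The boundary values of the 2×2 matrix function `S` exist and are unitary a.e. on `γ`. -/
def UnitaryAEOn (S : ℂ → Matrix (Fin 2) (Fin 2) ℂ) (γ : Set ℝ) : Prop :=
  ∀ᵐ θ ∂(volume.restrict γ), ∃ W : Matrix (Fin 2) (Fin 2) ℂ,
    (∀ i j, RadLim (fun z => S z i j) θ (W i j)) ∧ Wᴴ * W = 1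

/-- An outer function on the unit disk (normalized, with multiplicative constant 1):
`f z = exp (∫_𝕋 (t+z)/(t-z) φ(t) dm(t))` for some real integrable boundary data `φ`,
`m` being normalized Lebesgue measure on 𝕋. -/
def IsOuter (f : ℂ → ℂ) : Prop :=
  ∃ φ : ℝ → ℝ, IntegrableOn φ circleSet ∧
    ∀ z ∈ unitDisk, f z =
      Complex.exp (∫ θ in circleSet,
        ((circlePt θ + z) / (circlePt θ - z)) * (φ θ : ℂ) / (2 * Real.pi))

/-- The Poisson kernel of the unit disk at `r * circlePt θ`, as a function of the angle `t`. -/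
def diskPoisson (r θ t : ℝ) : ℝ :=
  (1 - r ^ 2) / (1 - 2 * r * Real.cos (t - θ) + r ^ 2)

lemma norm_circlePt (θ : ℝ) : ‖circlePt θ‖ = 1 := Complex.norm_exp_ofReal_mul_I θ

lemma circlePt_eq_circleMap (θ : ℝ) : circlePt θ = circleMap 0 1 θ := by
  simp [circlePt, circleMap]

lemma norm_circlePt_sub_sq (r θ t : ℝ) :
    ‖circlePt t - r * circlePt θ‖ ^ 2 = 1 - 2 * r * Real.cos (t - θ) + r ^ 2 := by
  rw [← Complex.normSq_eq_norm_sq, Complex.normSq_apply]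
  simp only [circlePt, Complex.sub_re, Complex.sub_im, Complex.re_ofReal_mul,
    Complex.im_ofReal_mul, Complex.exp_ofReal_mul_I_re, Complex.exp_ofReal_mul_I_im, Real.cos_sub]
  nlinarith [Real.sin_sq_add_cos_sq t, Real.sin_sq_add_cos_sq θ]

lemma diskPoisson_eq_poissonKernel (r θ t : ℝ) :
    diskPoisson r θ t = poissonKernel 0 (r * circlePt θ) (circleMap 0 1 t) := by
  rw [poissonKernel, ← circlePt_eq_circleMap, sub_zero, sub_zero, norm_circlePt_sub_sq]
  simp [diskPoisson, norm_circlePt]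

lemma diskPoisson_denom_pos {r : ℝ} (hr : r ∈ Ioo (0 : ℝ) 1) (θ t : ℝ) :
    0 < 1 - 2 * r * Real.cos (t - θ) + r ^ 2 := by
  nlinarith [Real.cos_le_one (t - θ), hr.1, hr.2, mul_nonneg hr.1.le
    (sub_nonneg.2 (Real.cos_le_one (t - θ))), sq_pos_of_pos (sub_pos.2 hr.2)]

lemma diskPoisson_nonneg {r : ℝ} (hr : r ∈ Ioo (0 : ℝ) 1) (θ t : ℝ) : 0 ≤ diskPoisson r θ t :=
  div_nonneg (by nlinarith [hr.1, hr.2]) (diskPoisson_denom_pos hr θ t).le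

lemma contDiff_diskPoisson {r : ℝ} (hr : r ∈ Ioo (0 : ℝ) 1) (θ : ℝ) :
    ContDiff ℝ 1 (diskPoisson r θ) := by
  unfold diskPoisson
  refine ContDiff.div contDiff_const ?_ fun t => (diskPoisson_denom_pos hr θ t).ne'
  fun_prop

/-- The angular derivative of `diskPoisson`. -/
def diskPoissonDeriv (r θ t : ℝ) : ℝ :=
  -((1 - r ^ 2) * (2 * r * Real.sin (t - θ))) / (1 - 2 * r * Real.cos (t - θ) + r ^ 2) ^ 2

lemma hasDerivAt_diskPoisson {r : ℝ} (hr : r ∈ Ioo (0 : ℝ) 1) (θ t : ℝ) :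
    HasDerivAt (diskPoisson r θ) (diskPoissonDeriv r θ t) t := by
  have h1 : HasDerivAt (fun t : ℝ => 1 - 2 * r * Real.cos (t - θ) + r ^ 2)
      (2 * r * Real.sin (t - θ)) t := by
    have := ((((hasDerivAt_id t).sub_const θ).cos.const_mul (2 * r)).const_sub 1).add_const (r ^ 2)
    exact this.congr_deriv (by simp)
  have := (hasDerivAt_const t (1 - r ^ 2)).div h1 (diskPoisson_denom_pos hr θ t).ne'
  exact this.congr_deriv (by simp [diskPoissonDeriv])

lemma continuous_diskPoissonDeriv {r : ℝ} (hr : r ∈ Ioo (0 : ℝ) 1) (θ : ℝ) :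
    Continuous (diskPoissonDeriv r θ) := by
  unfold diskPoissonDeriv
  refine Continuous.div (by fun_prop) (by fun_prop) fun t => ?_
  exact pow_ne_zero _ (diskPoisson_denom_pos hr θ t).ne'

lemma integral_diskPoisson {r : ℝ} (hr : r ∈ Ioo (0 : ℝ) 1) (θ : ℝ) :
    ∫ t in (0 : ℝ)..2 * Real.pi, diskPoisson r θ t = 2 * Real.pi := by
  have h : DiffContOnCl ℂ (fun _ : ℂ => (1 : ℂ)) (Metric.ball 0 1) :=
    diffContOnCl_const
  have hw : (r * circlePt θ : ℂ) ∈ Metric.ball (0 : ℂ) 1 := by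
    simp [norm_circlePt, abs_of_pos hr.1, hr.2]
  have := h.circleAverage_poissonKernel_smul hw
  simp only [Real.circleAverage_def, Pi.smul_apply', ← diskPoisson_eq_poissonKernel,
    Complex.real_smul, mul_one, intervalIntegral.integral_ofReal] at this
  have h2 : (2 * Real.pi)⁻¹ * ∫ t in (0 : ℝ)..2 * Real.pi, diskPoisson r θ t = 1 := by
    exact_mod_cast this
  have := Real.pi_pos
  field_simp at h2
  linarith

lemma cos_le_cos_of_mem {x δ : ℝ} (h0 : 0 ≤ δ) (h1 : δ ≤ |x|) (h2 : |x| ≤ 2 * Real.pi - δ) :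
    Real.cos x ≤ Real.cos δ := by
  rw [← Real.cos_abs x]
  rcases le_total |x| Real.pi with h | h
  · exact Real.cos_le_cos_of_nonneg_of_le_pi h0 h h1
  · rw [← Real.cos_two_pi_sub |x|]
    exact Real.cos_le_cos_of_nonneg_of_le_pi h0 (by linarith) (by linarith)

lemma diskPoisson_le {r θ t δ : ℝ} (hr : r ∈ Ioo (1 / 2 : ℝ) 1) (hδ : Real.cos δ < 1)
    (h : Real.cos (t - θ) ≤ Real.cos δ) :
    diskPoisson r θ t ≤ (1 - r ^ 2) / (1 - Real.cos δ) := by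
  unfold diskPoisson
  refine div_le_div_of_nonneg_left (by nlinarith [hr.1, hr.2]) (by linarith) ?_
  nlinarith [hr.1, hr.2, sq_nonneg (1 - r), Real.neg_one_le_cos δ,
    mul_nonneg (show 0 ≤ 2 * r by linarith [hr.1]) (sub_nonneg.2 h),
    mul_nonneg (show 0 ≤ 2 * r - 1 by linarith [hr.1]) (sub_nonneg.2 hδ.le)]

lemma abs_diskPoissonDeriv_le {r θ t δ : ℝ} (hr : r ∈ Ioo (1 / 2 : ℝ) 1) (hδ : Real.cos δ < 1)
    (h : Real.cos (t - θ) ≤ Real.cos δ) :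
    |diskPoissonDeriv r θ t| ≤ 2 * (1 - r ^ 2) / (1 - Real.cos δ) ^ 2 := by
  unfold diskPoissonDeriv
  have h1 : 0 ≤ 1 - r ^ 2 := by nlinarith [hr.1, hr.2]
  have h3 : (1 - Real.cos δ) ≤ 1 - 2 * r * Real.cos (t - θ) + r ^ 2 := by
    nlinarith [hr.1, hr.2, sq_nonneg (1 - r), Real.neg_one_le_cos δ,
      mul_nonneg (show 0 ≤ 2 * r by linarith [hr.1]) (sub_nonneg.2 h),
      mul_nonneg (show 0 ≤ 2 * r - 1 by linarith [hr.1]) (sub_nonneg.2 hδ.le)]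
  rw [abs_div, abs_neg, abs_mul, abs_of_nonneg h1, abs_pow, sq_abs, mul_comm 2 (1 - r ^ 2)]
  have h4 : 0 < 1 - Real.cos δ := sub_pos.2 hδ
  gcongr
  · rw [abs_mul, abs_of_pos (by linarith [hr.1])]
    nlinarith [Real.abs_sin_le_one (t - θ), hr.1, hr.2, abs_nonneg (Real.sin (t - θ))]

lemma tendsto_const_mul_one_sub_sq (C : ℝ) :
    Tendsto (fun r : ℝ => C * (1 - r ^ 2)) (nhdsWithin 1 (Iio 1)) (nhds 0) := by
  have : Continuous (fun r : ℝ => C * (1 - r ^ 2)) := by fun_prop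
  simpa using (this.tendsto 1).mono_left nhdsWithin_le_nhds

lemma eventually_mem_Ioo_half : ∀ᶠ r : ℝ in nhdsWithin 1 (Iio 1), r ∈ Ioo (1 / 2 : ℝ) 1 :=
  Ioo_mem_nhdsLT (by norm_num)

lemma tendsto_diskPoisson {θ t : ℝ} (h : Real.cos (t - θ) < 1) :
    Tendsto (fun r => diskPoisson r θ t) (nhdsWithin 1 (Iio 1)) (nhds 0) := by
  refine squeeze_zero' ?_ ?_ (tendsto_const_mul_one_sub_sq (1 - Real.cos (t - θ))⁻¹)
  · filter_upwards [eventually_mem_Ioo_half] with r hr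
    exact diskPoisson_nonneg ⟨by linarith [hr.1], hr.2⟩ _ _
  · filter_upwards [eventually_mem_Ioo_half] with r hr
    rw [mul_comm, ← div_eq_mul_inv]
    exact diskPoisson_le hr h le_rfl

lemma tendsto_integral_diskPoisson_far {ψ : ℝ → ℝ} {θ δ x y : ℝ} (hδ : 0 < δ)
    (hδπ : δ ≤ Real.pi) (hxy : x ≤ y)
    (hψ : IntervalIntegrable ψ volume x y)
    (h : ∀ t ∈ Icc x y, δ ≤ |t - θ| ∧ |t - θ| ≤ 2 * Real.pi - δ) :
    Tendsto (fun r => ∫ t in x..y, diskPoisson r θ t * ψ t) (nhdsWithin 1 (Iio 1)) (nhds 0) := by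
  have hc : Real.cos δ < 1 := by
    rw [← Real.cos_zero]
    exact Real.cos_lt_cos_of_nonneg_of_le_pi le_rfl hδπ hδ
  refine squeeze_zero_norm' (a := fun r => ((1 - Real.cos δ)⁻¹ * ∫ t in x..y, |ψ t|) * (1 - r ^ 2))
    ?_ (tendsto_const_mul_one_sub_sq _)
  filter_upwards [eventually_mem_Ioo_half] with r hr
  have hr' : r ∈ Ioo (0 : ℝ) 1 := ⟨by linarith [hr.1], hr.2⟩
  calc ‖∫ t in x..y, diskPoisson r θ t * ψ t‖
      ≤ ∫ t in x..y, (1 - r ^ 2) / (1 - Real.cos δ) * |ψ t| := by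
        refine intervalIntegral.norm_integral_le_of_norm_le hxy ?_ (hψ.abs.const_mul _)
        refine ae_of_all _ fun t ht => ?_
        rw [norm_mul, Real.norm_eq_abs, Real.norm_eq_abs,
          abs_of_nonneg (diskPoisson_nonneg hr' _ _)]
        have := h t (Ioc_subset_Icc_self ht)
        gcongr
        exact diskPoisson_le hr hc (cos_le_cos_of_mem hδ.le this.1 this.2)
    _ = _ := by
        rw [intervalIntegral.integral_const_mul]
        ring

lemma intervalIntegrable_diskPoisson_mul {ψ : ℝ → ℝ} {r x y : ℝ} (hr : r ∈ Ioo (0 : ℝ) 1) (θ : ℝ)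
    (hψ : IntervalIntegrable ψ volume x y) :
    IntervalIntegrable (fun t => diskPoisson r θ t * ψ t) volume x y :=
  hψ.continuousOn_mul (contDiff_diskPoisson hr θ).continuous.continuousOn

lemma tendsto_integral_diskPoisson_near {ψ : ℝ → ℝ} {θ δ L : ℝ} (hδ : 0 < δ)
    (h1 : 0 ≤ θ - δ) (h2 : θ + δ ≤ 2 * Real.pi) (hδ1 : δ ≤ θ - δ) (hδ2 : δ ≤ 2 * Real.pi - (θ + δ))
    (hψ : IntervalIntegrable ψ volume 0 (2 * Real.pi))
    (hL : Tendsto (fun r => ∫ t in (θ - δ)..(θ + δ), diskPoisson r θ t * ψ t)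
      (nhdsWithin 1 (Iio 1)) (nhds L)) :
    Tendsto (fun r => ∫ t in 0..2 * Real.pi, diskPoisson r θ t * ψ t)
      (nhdsWithin 1 (Iio 1)) (nhds L) := by
  have hi : ∀ {x y}, 0 ≤ x → x ≤ y → y ≤ 2 * Real.pi → IntervalIntegrable ψ volume x y := by
    intro x y hx hxy hy
    refine hψ.mono_set ?_
    rw [uIcc_of_le hxy, uIcc_of_le (by linarith)]
    exact Icc_subset_Icc hx hy
  have hA := tendsto_integral_diskPoisson_far (θ := θ) hδ (by linarith) h1
    (hi le_rfl h1 (by linarith)) (fun t ht => by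
      rw [abs_of_nonpos (by linarith [ht.2])]; constructor <;> linarith [ht.1, ht.2])
  have hB := tendsto_integral_diskPoisson_far (θ := θ) hδ (by linarith) h2
    (hi (by linarith) h2 le_rfl) (fun t ht => by
      rw [abs_of_nonneg (by linarith [ht.1])]; constructor <;> linarith [ht.1, ht.2])
  have := (hA.add hL).add hB
  rw [zero_add, add_zero] at this
  refine this.congr' ?_
  filter_upwards [eventually_mem_Ioo_half] with r hr
  have hr' : r ∈ Ioo (0 : ℝ) 1 := ⟨by linarith [hr.1], hr.2⟩
  have i1 := intervalIntegrable_diskPoisson_mul hr' θ (hi le_rfl h1 (by linarith))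
  have i2 := intervalIntegrable_diskPoisson_mul hr' θ
    (hi h1 (by linarith : θ - δ ≤ θ + δ) (by linarith))
  have i3 := intervalIntegrable_diskPoisson_mul hr' θ (hi (by linarith) h2 le_rfl)
  rw [intervalIntegral.integral_add_adjacent_intervals i1 i2,
    intervalIntegral.integral_add_adjacent_intervals (i1.trans i2) i3]

/-- The Poisson integral of `ψ` converges radially to `ψ θ` at every `θ` at which the indefinite
integral of `ψ` has derivative `ψ θ`. -/
lemma tendsto_integral_diskPoisson {ψ : ℝ → ℝ} {θ : ℝ} (hθ : θ ∈ Ioo 0 (2 * Real.pi))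
    (hψ : IntervalIntegrable ψ volume 0 (2 * Real.pi))
    (hd : HasDerivAt (fun x => ∫ t in θ..x, ψ t) (ψ θ) θ) :
    Tendsto (fun r => ∫ t in 0..2 * Real.pi, diskPoisson r θ t * ψ t)
      (nhdsWithin 1 (Iio 1)) (nhds (2 * Real.pi * ψ θ)) := by
  obtain ⟨δ, hδ, hδ1, hδ2⟩ : ∃ δ : ℝ, 0 < δ ∧ δ ≤ θ - δ ∧ δ ≤ 2 * Real.pi - (θ + δ) := by
    refine ⟨min θ (2 * Real.pi - θ) / 2, ?_, ?_, ?_⟩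
    · have := lt_min hθ.1 (sub_pos.2 hθ.2); linarith
    · linarith [min_le_left θ (2 * Real.pi - θ)]
    · linarith [min_le_right θ (2 * Real.pi - θ)]
  have hAB : θ - δ ≤ θ + δ := by linarith
  have hδπ : δ < Real.pi := by linarith [hθ.1]
  have hψ' : IntervalIntegrable ψ volume (θ - δ) (θ + δ) := by
    refine hψ.mono_set ?_
    rw [uIcc_of_le hAB, uIcc_of_le (by linarith)]
    exact Icc_subset_Icc (by linarith) (by linarith)
  refine tendsto_integral_diskPoisson_near hδ (by linarith) (by linarith) hδ1 hδ2 hψ ?_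
  set F : ℝ → ℝ := fun x => ∫ t in θ..x, ψ t with hF
  have hF0 : F θ = 0 := by simp [hF]
  have hFac : AbsolutelyContinuousOnInterval F (θ - δ) (θ + δ) :=
    hψ'.absolutelyContinuousOnInterval_intervalIntegral (by
      rw [uIcc_of_le hAB]; constructor <;> linarith)
  have hcos : Real.cos δ < 1 := by
    rw [← Real.cos_zero]
    exact Real.cos_lt_cos_of_nonneg_of_le_pi le_rfl hδπ.le hδ
  have hend1 : Tendsto (fun r => diskPoisson r θ (θ + δ)) (nhdsWithin 1 (Iio 1)) (nhds 0) :=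
    tendsto_diskPoisson (by simpa using hcos)
  have hend2 : Tendsto (fun r => diskPoisson r θ (θ - δ)) (nhdsWithin 1 (Iio 1)) (nhds 0) :=
    tendsto_diskPoisson (by simpa using hcos)
  have hone : Tendsto (fun r => ∫ t in (θ - δ)..(θ + δ), diskPoisson r θ t)
      (nhdsWithin 1 (Iio 1)) (nhds (2 * Real.pi)) := by
    have hA := tendsto_integral_diskPoisson_far (ψ := fun _ => 1) (θ := θ) hδ hδπ.le
      (show 0 ≤ θ - δ by linarith) intervalIntegrable_const (fun t ht => by
        rw [abs_of_nonpos (by linarith [ht.2])]; constructor <;> linarith [ht.1, ht.2])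
    have hB := tendsto_integral_diskPoisson_far (ψ := fun _ => 1) (θ := θ) hδ hδπ.le
      (show θ + δ ≤ 2 * Real.pi by linarith) intervalIntegrable_const (fun t ht => by
        rw [abs_of_nonneg (by linarith [ht.1])]; constructor <;> linarith [ht.1, ht.2])
    have := ((tendsto_const_nhds (x := 2 * Real.pi)).sub hA).sub hB
    rw [sub_zero, sub_zero] at this
    refine this.congr' ?_
    filter_upwards [eventually_mem_Ioo_half] with r hr
    have hr' : r ∈ Ioo (0 : ℝ) 1 := ⟨by linarith [hr.1], hr.2⟩
    have hi : ∀ x y, IntervalIntegrable (diskPoisson r θ) volume x y :=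
      fun x y => (contDiff_diskPoisson hr' θ).continuous.intervalIntegrable x y
    have e1 := intervalIntegral.integral_add_adjacent_intervals
      (hi 0 (θ - δ)) (hi (θ - δ) (2 * Real.pi))
    have e2 := intervalIntegral.integral_add_adjacent_intervals
      (hi (θ - δ) (θ + δ)) (hi (θ + δ) (2 * Real.pi))
    rw [integral_diskPoisson hr' θ] at e1
    simp only [mul_one]
    linarith
  have hq : Tendsto (fun r => ∫ t in (θ - δ)..(θ + δ),
      (2 * Real.pi)⁻¹ * ((θ - t) * diskPoissonDeriv r θ t)) (nhdsWithin 1 (Iio 1)) (nhds 1) := by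
    have := (((hend1.const_mul (-δ)).sub (hend2.const_mul δ)).add hone).const_mul (2 * Real.pi)⁻¹
    rw [mul_zero, mul_zero, sub_zero, zero_add, inv_mul_cancel₀ Real.two_pi_pos.ne'] at this
    refine this.congr' ?_
    filter_upwards [eventually_mem_Ioo_half] with r hr
    have hr' : r ∈ Ioo (0 : ℝ) 1 := ⟨by linarith [hr.1], hr.2⟩
    rw [intervalIntegral.integral_const_mul,
      intervalIntegral.integral_mul_deriv_eq_deriv_mul (u := fun t => θ - t) (u' := fun _ => -1)
        (fun t _ => by simpa using (hasDerivAt_id t).const_sub θ)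
        (fun t _ => hasDerivAt_diskPoisson hr' θ t) intervalIntegrable_const
        ((continuous_diskPoissonDeriv hr' θ).intervalIntegrable _ _)]
    simp only [neg_one_mul, intervalIntegral.integral_neg]
    ring
  have hslope : Tendsto (fun r => ∫ t in Ioc (θ - δ) (θ + δ),
      ((2 * Real.pi)⁻¹ * ((θ - t) * diskPoissonDeriv r θ t)) • dslope F θ t)
      (nhdsWithin 1 (Iio 1)) (nhds (ψ θ)) := by
    have hnhds : Ioc (θ - δ) (θ + δ) ∈ nhds θ := Ioc_mem_nhds (by linarith) (by linarith)
    refine tendsto_setIntegral_peak_smul_of_integrableOn_of_tendsto (x₀ := θ) measurableSet_Ioc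
      measurableSet_Ioc subset_rfl self_mem_nhdsWithin
      (by simp) ?_ ?_ ?_ ?_ ?_ ?_
    · filter_upwards [eventually_mem_Ioo_half] with r hr t ht
      have hr' : r ∈ Ioo (0 : ℝ) 1 := ⟨by linarith [hr.1], hr.2⟩
      refine mul_nonneg (by positivity) ?_
      have h1 : 0 ≤ (t - θ) * Real.sin (t - θ) := by
        rcases le_total 0 (t - θ) with h | h
        · exact mul_nonneg h (Real.sin_nonneg_of_nonneg_of_le_pi h (by linarith [ht.2]))
        · exact mul_nonneg_of_nonpos_of_nonpos h
            (Real.sin_nonpos_of_nonpos_of_neg_pi_le h (by linarith [ht.1]))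
      have h2 : (θ - t) * diskPoissonDeriv r θ t = (1 - r ^ 2) * (2 * r) *
          ((t - θ) * Real.sin (t - θ)) / (1 - 2 * r * Real.cos (t - θ) + r ^ 2) ^ 2 := by
        unfold diskPoissonDeriv; ring
      rw [h2]
      have : 0 ≤ 1 - r ^ 2 := by nlinarith [hr.1, hr.2]
      have := hr'.1.le
      positivity
    · intro u hu hθu
      obtain ⟨η, hη, hηu⟩ := Metric.isOpen_iff.1 hu θ hθu
      have hm : 0 < min η δ := lt_min hη hδ
      have hmc : Real.cos (min η δ) < 1 := by
        rw [← Real.cos_zero]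
        exact Real.cos_lt_cos_of_nonneg_of_le_pi le_rfl
          ((min_le_right _ _).trans hδπ.le) hm
      rw [Metric.tendstoUniformlyOn_iff]
      intro ε hε
      have := tendsto_const_mul_one_sub_sq
        ((2 * Real.pi)⁻¹ * (δ * (2 / (1 - Real.cos (min η δ)) ^ 2)))
      filter_upwards [eventually_mem_Ioo_half, this.eventually_lt_const hε] with r hr hlt t ht
      refine lt_of_le_of_lt ?_ hlt
      have h1 : |θ - t| ≤ δ := abs_le.2 ⟨by linarith [ht.1.2], by linarith [ht.1.1]⟩
      have h2 : η ≤ |t - θ| := by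
        by_contra! h
        exact ht.2 (hηu (by simpa [Real.dist_eq] using h))
      have h3 : |t - θ| ≤ δ := by rwa [abs_sub_comm]
      have h4 := abs_diskPoissonDeriv_le hr hmc (cos_le_cos_of_mem (x := t - θ) hm.le
        ((min_le_left _ _).trans h2) (by linarith [min_le_right η δ]))
      simp only [Pi.zero_apply, dist_zero_left, norm_mul, Real.norm_eq_abs]
      rw [abs_of_pos (by positivity : (0 : ℝ) < (2 * Real.pi)⁻¹), mul_assoc, mul_assoc]
      gcongr
      exact h4.trans_eq (by ring)
    · simpa only [intervalIntegral.integral_of_le hAB] using hq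
    · filter_upwards [eventually_mem_Ioo_half] with r hr
      have hr' : r ∈ Ioo (0 : ℝ) 1 := ⟨by linarith [hr.1], hr.2⟩
      have := continuous_diskPoissonDeriv hr' θ
      exact (show Continuous fun t => (2 * Real.pi)⁻¹ * ((θ - t) * diskPoissonDeriv r θ t) by
        fun_prop).aestronglyMeasurable
    · have hcont : ContinuousOn (dslope F θ) (Icc (θ - δ) (θ + δ)) := by
        rw [continuousOn_dslope (Icc_mem_nhds (by linarith) (by linarith))]
        refine ⟨?_, hd.differentiableAt⟩
        simpa only [uIcc_of_le hAB] using hFac.continuousOn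
      exact hcont.integrableOn_Icc.mono_set Ioc_subset_Icc_self
    · have : ContinuousAt (dslope F θ) θ := continuousAt_dslope_same.2 hd.differentiableAt
      have h := this.tendsto
      rw [dslope_same, hd.deriv] at h
      exact h.mono_left nhdsWithin_le_nhds
  have hsum := ((hend1.mul_const (F (θ + δ))).sub (hend2.mul_const (F (θ - δ)))).add
    (hslope.const_mul (2 * Real.pi))
  rw [zero_mul, zero_mul, sub_zero, zero_add] at hsum
  refine hsum.congr' ?_
  filter_upwards [eventually_mem_Ioo_half] with r hr
  have hr' : r ∈ Ioo (0 : ℝ) 1 := ⟨by linarith [hr.1], hr.2⟩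
  have hder : ∀ᵐ t, t ∈ uIoc (θ - δ) (θ + δ) → diskPoisson r θ t * ψ t =
      diskPoisson r θ t * deriv F t := by
    filter_upwards [hψ'.ae_hasDerivAt_integral] with t ht htm
    rw [(ht (uIoc_subset_uIcc htm) θ (by rw [uIcc_of_le hAB]; constructor <;> linarith)).deriv]
  rw [intervalIntegral.integral_congr_ae hder,
    AbsolutelyContinuousOnInterval.integral_mul_deriv_eq_deriv_mul
      (contDiff_diskPoisson hr' θ).contDiffOn.absolutelyContinuousOnInterval hFac,
    ← intervalIntegral.integral_of_le hAB, sub_eq_add_neg (_ - _),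
    ← intervalIntegral.integral_neg]
  refine congrArg _ ((intervalIntegral.integral_const_mul _ _).symm.trans
    (intervalIntegral.integral_congr (fun t _ => ?_)))
  have h1 : (t - θ) * dslope F θ t = F t := by
    simpa [hF0] using sub_smul_dslope F θ t
  simp only [smul_eq_mul]
  rw [(hasDerivAt_diskPoisson hr' θ t).deriv, ← h1]
  have := Real.pi_pos
  field_simp
  ring

/-- Radial limits of Poisson integrals exist almost everywhere. -/
lemma ae_tendsto_integral_diskPoisson {ψ : ℝ → ℝ}
    (hψ : IntervalIntegrable ψ volume 0 (2 * Real.pi)) :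
    ∀ᵐ θ ∂(volume.restrict (Ioo 0 (2 * Real.pi))),
      Tendsto (fun r => ∫ t in 0..2 * Real.pi, diskPoisson r θ t * ψ t)
        (nhdsWithin 1 (Iio 1)) (nhds (2 * Real.pi * ψ θ)) := by
  rw [ae_restrict_iff' measurableSet_Ioo]
  filter_upwards [hψ.ae_hasDerivAt_integral] with θ h hθ
  have : θ ∈ uIcc 0 (2 * Real.pi) := by
    rw [uIcc_of_le Real.two_pi_pos.le]
    exact Ioo_subset_Icc_self hθ
  exact tendsto_integral_diskPoisson hθ hψ (h this θ this)

lemma isOpen_unitDisk : IsOpen unitDisk := isOpen_lt continuous_norm continuous_const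

lemma unitDisk_eq_ball : unitDisk = Metric.ball 0 1 := by
  ext z; simp [unitDisk]

lemma mul_circlePt_mem_unitDisk {r : ℝ} (hr : r ∈ Ioo (0 : ℝ) 1) (θ : ℝ) :
    (r * circlePt θ : ℂ) ∈ unitDisk := by
  simp [unitDisk, norm_circlePt, abs_of_pos hr.1, hr.2]

lemma continuous_circlePt : Continuous circlePt := by
  unfold circlePt; fun_prop

lemma SchurFn.continuous_mul_circlePt {f : ℂ → ℂ} (hf : SchurFn f) {r : ℝ}
    (hr : r ∈ Ioo (0 : ℝ) 1) : Continuous fun t : ℝ => f (r * circlePt t) :=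
  hf.1.continuousOn.comp_continuous (continuous_const.mul continuous_circlePt)
    fun t => mul_circlePt_mem_unitDisk hr t

/-- The Poisson formula for a dilation of a Schur function. -/
lemma SchurFn.integral_diskPoisson {f : ℂ → ℂ} (hf : SchurFn f) {ρ r : ℝ}
    (hρ : ρ ∈ Ioo (0 : ℝ) 1) (hr : r ∈ Ioo (0 : ℝ) 1) (θ : ℝ) :
    ∫ t in Ioc 0 (2 * Real.pi), (diskPoisson r θ t : ℂ) * f (ρ * circlePt t) =
      2 * Real.pi * f (ρ * (r * circlePt θ)) := by
  have hd : DiffContOnCl ℂ (fun z => f (ρ * z)) (Metric.ball 0 1) := by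
    refine DifferentiableOn.diffContOnCl_ball (U := (fun z : ℂ => ρ * z) ⁻¹' unitDisk)
      (hf.1.comp (by fun_prop) (mapsTo_preimage _ _)) fun z hz => ?_
    have hz' : ‖z‖ ≤ 1 := by simpa using hz
    have : ‖(ρ : ℂ) * z‖ < 1 := by
      rw [norm_mul, Complex.norm_real, Real.norm_of_nonneg hρ.1.le]
      nlinarith [hρ.1, hρ.2, norm_nonneg z]
    exact this
  have hw : (r * circlePt θ : ℂ) ∈ Metric.ball (0 : ℂ) 1 :=
    unitDisk_eq_ball ▸ mul_circlePt_mem_unitDisk hr θ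
  have := hd.circleAverage_poissonKernel_smul hw
  simp only [Real.circleAverage_def, Pi.smul_apply', ← diskPoisson_eq_poissonKernel,
    Complex.real_smul] at this
  simp only [← circlePt_eq_circleMap] at this
  rw [intervalIntegral.integral_of_le Real.two_pi_pos.le] at this
  rw [← this]
  push_cast
  rw [← mul_assoc, mul_inv_cancel₀ (by exact_mod_cast Real.two_pi_pos.ne'), one_mul]

/-- A Schur function is the Poisson integral of an integrable boundary function. -/
lemma SchurFn.exists_poisson {f : ℂ → ℂ} (hf : SchurFn f) :
    ∃ g : ℝ → ℂ, IntegrableOn g (Ioc 0 (2 * Real.pi)) ∧ ∀ r ∈ Ioo (0 : ℝ) 1, ∀ θ,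
      ∫ t in Ioc 0 (2 * Real.pi), (diskPoisson r θ t : ℂ) * g t =
        2 * Real.pi * f (r * circlePt θ) := by
  set μ : Measure ℝ := volume.restrict (Ioc 0 (2 * Real.pi)) with hμ
  let ρ : ℕ → ℝ := fun n => 1 - 1 / ((n : ℝ) + 2)
  have hρ : ∀ n, ρ n ∈ Ioo (0 : ℝ) 1 := fun n => by
    have h2 : (0 : ℝ) < n + 2 := by positivity
    constructor
    · have : 1 / ((n : ℝ) + 2) < 1 := by rw [div_lt_one h2]; linarith [n.cast_nonneg (α := ℝ)]
      simp only [ρ]; linarith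
    · have : 0 < 1 / ((n : ℝ) + 2) := by positivity
      simp only [ρ]; linarith
  have hρlim : Tendsto ρ atTop (nhds 1) := by
    have : Tendsto (fun n : ℕ => 1 / ((n : ℝ) + 2)) atTop (nhds 0) := by
      simpa [Function.comp_def] using (tendsto_const_div_atTop_nhds_zero_nat (1 : ℝ)).comp (tendsto_add_atTop_nat 2)
    simpa [ρ] using this.const_sub 1
  have hmem : ∀ n, MemLp (fun t : ℝ => f (ρ n * circlePt t)) 2 μ := fun n =>
    MemLp.of_bound (hf.continuous_mul_circlePt (hρ n)).aestronglyMeasurable 1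
      (ae_of_all _ fun t => hf.2 _ (mul_circlePt_mem_unitDisk (hρ n) t))
  let x : ℕ → StrongDual ℂ (Lp ℂ 2 μ) := fun n =>
    InnerProductSpace.toDual ℂ (Lp ℂ 2 μ) ((hmem n).toLp _)
  obtain ⟨C, hC⟩ : ∃ C : ℝ, ∀ n, ‖x n‖ ≤ C := by
    refine ⟨(measureUnivNNReal μ : ℝ) ^ (2 : ENNReal).toReal⁻¹ * 1, fun n => ?_⟩
    rw [LinearIsometryEquiv.norm_map]
    refine Lp.norm_le_of_ae_bound zero_le_one ?_
    filter_upwards [(hmem n).coeFn_toLp] with t ht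
    rw [ht]
    exact hf.2 _ (mul_circlePt_mem_unitDisk (hρ n) t)
  have : Fact ((2 : ENNReal) ≠ ⊤) := ⟨by simp⟩
  obtain ⟨a, -, φ, hφ, hlim⟩ := WeakDual.isSeqCompact_closedBall ℂ (Lp ℂ 2 μ) 0 C
    (x := fun n => StrongDual.toWeakDual (x n)) (fun n => by simpa using hC n)
  let g : Lp ℂ 2 μ := (InnerProductSpace.toDual ℂ (Lp ℂ 2 μ)).symm (WeakDual.toStrongDual a)
  refine ⟨g, (Lp.memLp g).integrable (by norm_num), fun r hr θ => ?_⟩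
  have hkmem : MemLp (fun t : ℝ => (diskPoisson r θ t : ℂ)) 2 μ := by
    have hcont : Continuous (fun t : ℝ => (diskPoisson r θ t : ℂ)) :=
      Complex.continuous_ofReal.comp (contDiff_diskPoisson hr θ).continuous
    have hle : μ ≤ volume.restrict (Icc 0 (2 * Real.pi)) :=
      Measure.restrict_mono Ioc_subset_Icc_self le_rfl
    obtain ⟨B, hB⟩ := isCompact_Icc.exists_bound_of_continuousOn
      (s := Icc 0 (2 * Real.pi)) hcont.continuousOn
    exact MemLp.of_bound hcont.aestronglyMeasurable B
      ((ae_restrict_iff' measurableSet_Ioc).2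
        (ae_of_all _ fun t ht => hB t (Ioc_subset_Icc_self ht)))
  have hinner : ∀ h : Lp ℂ 2 μ, inner ℂ (hkmem.toLp _) h =
      ∫ t, (diskPoisson r θ t : ℂ) * h t ∂μ := by
    intro h
    rw [L2.inner_def]
    refine integral_congr_ae ?_
    filter_upwards [hkmem.coeFn_toLp] with t ht
    rw [ht]
    simp [mul_comm]
  have h1 : Tendsto (fun n => inner ℂ ((hmem (φ n)).toLp _) (hkmem.toLp _)) atTop
      (nhds (inner ℂ g (hkmem.toLp _))) := by
    have := ((WeakDual.eval_continuous (hkmem.toLp _)).tendsto a).comp hlim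
    rw [InnerProductSpace.toDual_symm_apply]
    exact this
  have h2 := (Complex.continuous_conj.tendsto _).comp h1
  simp only [Function.comp_def, inner_conj_symm, hinner] at h2
  refine tendsto_nhds_unique h2 ?_
  have h3 : ∀ n, ∫ t, (diskPoisson r θ t : ℂ) * ((hmem (φ n)).toLp _ : Lp ℂ 2 μ) t ∂μ =
      2 * Real.pi * f (ρ (φ n) * (r * circlePt θ)) := by
    intro n
    rw [← hf.integral_diskPoisson (hρ _) hr θ]
    refine integral_congr_ae ?_
    filter_upwards [(hmem (φ n)).coeFn_toLp] with t ht
    rw [ht]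
  simp only [h3]
  have h4 : ContinuousAt f (r * circlePt θ) :=
    (hf.1.differentiableAt (isOpen_unitDisk.mem_nhds (mul_circlePt_mem_unitDisk hr θ))).continuousAt
  have h5 : Tendsto (fun n => (ρ (φ n) : ℂ) * (r * circlePt θ)) atTop
      (nhds (r * circlePt θ)) := by
    have := (Complex.continuous_ofReal.tendsto 1).comp (hρlim.comp hφ.tendsto_atTop)
    simpa [Function.comp_def] using this.mul_const ((r : ℂ) * circlePt θ)
  exact (h4.tendsto.comp h5).const_mul _

/-- **Fatou's theorem** for Schur functions: radial limits exist almost everywhere. -/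
lemma SchurFn.ae_exists_radLim {f : ℂ → ℂ} (hf : SchurFn f) :
    ∀ᵐ θ ∂(volume.restrict (Ioo 0 (2 * Real.pi))), ∃ w, RadLim f θ w := by
  obtain ⟨g, hg, hgf⟩ := hf.exists_poisson
  have hre : IntervalIntegrable (fun t => (g t).re) volume 0 (2 * Real.pi) := by
    rw [intervalIntegrable_iff_integrableOn_Ioc_of_le Real.two_pi_pos.le]; exact hg.re
  have him : IntervalIntegrable (fun t => (g t).im) volume 0 (2 * Real.pi) := by
    rw [intervalIntegrable_iff_integrableOn_Ioc_of_le Real.two_pi_pos.le]; exact hg.im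
  filter_upwards [ae_tendsto_integral_diskPoisson hre, ae_tendsto_integral_diskPoisson him]
    with θ h1 h2
  refine ⟨(2 * Real.pi : ℂ)⁻¹ * ((2 * Real.pi * (g θ).re : ℝ) + (2 * Real.pi * (g θ).im : ℝ) * I), ?_⟩
  have h3 := ((((Complex.continuous_ofReal.tendsto _).comp h1).add
    (((Complex.continuous_ofReal.tendsto _).comp h2).mul_const I)).const_mul
      ((2 * Real.pi : ℂ)⁻¹))
  refine h3.congr' ?_
  filter_upwards [eventually_mem_Ioo_half] with r hr
  have hr' : r ∈ Ioo (0 : ℝ) 1 := ⟨by linarith [hr.1], hr.2⟩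
  have hpi : (2 * Real.pi : ℂ) ≠ 0 := by exact_mod_cast Real.two_pi_pos.ne'
  rw [inv_mul_eq_iff_eq_mul₀ hpi, ← hgf r hr' θ]
  have hint : IntegrableOn (fun t => (diskPoisson r θ t : ℂ) * g t) (Ioc 0 (2 * Real.pi)) := by
    rw [← intervalIntegrable_iff_integrableOn_Ioc_of_le Real.two_pi_pos.le] at hg ⊢
    exact hg.continuousOn_mul (Complex.continuous_ofReal.comp
      (contDiff_diskPoisson hr' θ).continuous).continuousOn
  rw [← integral_re_add_im hint]
  simp [intervalIntegral.integral_of_le Real.two_pi_pos.le]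

/-- A nonzero analytic function on a connected open set has no zeros on almost every ray. -/
lemma ae_forall_ne_zero {f : ℂ → ℂ} {U : Set ℂ} (hU : IsOpen U) (hc : IsPreconnected U)
    (hf : DifferentiableOn ℂ f U) (hne : ∃ z ∈ U, f z ≠ 0) :
    ∀ᵐ θ : ℝ, ∀ r : ℝ, 0 < r → (r * circlePt θ : ℂ) ∈ U → f (r * circlePt θ) ≠ 0 := by
  obtain ⟨z₀, hz₀, hfz₀⟩ := hne
  have hcod := (hf.analyticOnNhd hU).preimage_zero_mem_codiscreteWithin hfz₀ hz₀ ⟨⟨z₀, hz₀⟩, hc⟩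
  have hcount : ((f ⁻¹' {0}ᶜ)ᶜ ∩ U).Countable :=
    (HereditarilyLindelofSpace.isLindelof _).countable_of_isDiscrete
      (isDiscrete_of_codiscreteWithin (by rwa [compl_compl]))
  have hcount' := (hcount.image fun z => z / ‖z‖).preimage_circleMap 0 one_ne_zero
  rw [← compl_compl (circleMap 0 1 ⁻¹' _)] at hcount'
  filter_upwards [hcount'.ae_notMem volume] with θ hθ r hr hrU hzero
  refine hθ ?_
  rw [compl_compl]
  refine ⟨_, ⟨by simpa using hzero, hrU⟩, ?_⟩
  have : (r : ℂ) ≠ 0 := by exact_mod_cast hr.ne'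
  simp only [norm_mul, norm_circlePt, Complex.norm_real, Real.norm_of_nonneg hr.le, mul_one]
  rw [mul_div_cancel_left₀ _ this, circlePt_eq_circleMap]

lemma exists_le_circleAverage_log_norm {f : ℂ → ℂ} (hf : DifferentiableOn ℂ f unitDisk) :
    ∃ C : ℝ, ∀ R ∈ Ioo (1 / 2 : ℝ) 1, C ≤ Real.circleAverage (Real.log ‖f ·‖) 0 R := by
  refine ⟨((meromorphicOrderAt f 0).untop₀ : ℝ) * Real.log (1 / 2) +
    Real.log ‖meromorphicTrailingCoeffAt f 0‖, fun R hR => ?_⟩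
  have hR0 : 0 < R := by linarith [hR.1]
  have han : AnalyticOnNhd ℂ f (Metric.closedBall 0 |R|) :=
    (hf.analyticOnNhd isOpen_unitDisk).mono fun z hz => by
      rw [mem_closedBall_zero_iff, abs_of_pos hR0] at hz
      exact hz.trans_lt hR.2
  rw [han.meromorphicOn.circleAverage_log_norm hR0.ne']
  have hdiv : ∀ u, 0 ≤ MeromorphicOn.divisor f (Metric.closedBall 0 |R|) u := fun u =>
    MeromorphicOn.AnalyticOnNhd.divisor_nonneg han u
  have h1 : 0 ≤ ∑ᶠ u, (MeromorphicOn.divisor f (Metric.closedBall 0 |R|) u : ℝ) *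
      Real.log (R * ‖0 - u‖⁻¹) := by
    refine finsum_nonneg fun u => ?_
    by_cases hu : u ∈ Metric.closedBall (0 : ℂ) |R|
    · refine mul_nonneg (by exact_mod_cast hdiv u) ?_
      rcases eq_or_ne u 0 with rfl | hu0
      · simp
      · rw [mem_closedBall_zero_iff, abs_of_pos hR0] at hu
        refine Real.log_nonneg ?_
        rw [zero_sub, norm_neg, ← div_eq_mul_inv, le_div_iff₀ (norm_pos_iff.2 hu0), one_mul]
        exact hu
    · rw [Function.locallyFinsuppWithin.apply_eq_zero_of_notMem _ hu]; simp
  have h2 := hdiv 0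
  rw [MeromorphicOn.divisor_apply han.meromorphicOn (by simp)] at h2 ⊢
  have h3 : Real.log (1 / 2) ≤ Real.log R := Real.log_le_log (by norm_num) hR.1.le
  have h4 := mul_le_mul_of_nonneg_left h3 (by exact_mod_cast h2 : (0 : ℝ) ≤ (meromorphicOrderAt f 0).untop₀)
  linarith

/-- Boundary uniqueness: the radial limits of a nonzero Schur function vanish almost nowhere. -/
lemma SchurFn.ae_not_radLim_zero {f : ℂ → ℂ} (hf : SchurFn f) (hne : ∃ z ∈ unitDisk, f z ≠ 0) :
    ∀ᵐ θ ∂(volume.restrict (Ioo 0 (2 * Real.pi))), ¬ RadLim f θ 0 := by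
  obtain ⟨C, hC⟩ := exists_le_circleAverage_log_norm hf.1
  obtain ⟨ρ, -, hρ, hρlim⟩ := exists_seq_strictMono_tendsto' (show (1 / 2 : ℝ) < 1 by norm_num)
  have hρ' : ∀ n, ρ n ∈ Ioo (0 : ℝ) 1 := fun n => ⟨by linarith [(hρ n).1], (hρ n).2⟩
  let L : ℕ → ℝ → ENNReal := fun n θ => ENNReal.ofReal (-Real.log ‖f (ρ n * circlePt θ)‖)
  have hLm : ∀ n, Measurable (L n) := fun n =>
    ((Real.measurable_log.comp (hf.continuous_mul_circlePt (hρ' n)).norm.measurable).neg).ennreal_ofReal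
  have hnonneg : ∀ n θ, 0 ≤ -Real.log ‖f (ρ n * circlePt θ)‖ := fun n θ =>
    neg_nonneg.2 (Real.log_nonpos (norm_nonneg _) (hf.2 _ (mul_circlePt_mem_unitDisk (hρ' n) θ)))
  have hLint : ∀ n, ∫⁻ θ in Ioc 0 (2 * Real.pi), L n θ ≤ ENNReal.ofReal (2 * Real.pi * -C) := by
    intro n
    have hci : CircleIntegrable (Real.log ‖f ·‖) 0 (ρ n) := by
      refine MeromorphicOn.circleIntegrable_log_norm fun z hz => ?_
      refine ((hf.1.analyticOnNhd isOpen_unitDisk) z ?_).meromorphicAt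
      rw [mem_sphere_zero_iff_norm, abs_of_pos (hρ' n).1] at hz
      exact hz.trans_lt (hρ n).2
    have hcm : ∀ θ, circleMap 0 (ρ n) θ = ρ n * circlePt θ := fun θ => by
      simp [circleMap, circlePt]
    have hav := hC _ (hρ n)
    simp only [Real.circleAverage_def, hcm, smul_eq_mul] at hav
    rw [CircleIntegrable, intervalIntegrable_iff_integrableOn_Ioc_of_le Real.two_pi_pos.le] at hci
    simp only [hcm] at hci
    refine (ofReal_integral_eq_lintegral_ofReal hci.neg (ae_of_all _ (hnonneg n))).symm.trans_le ?_
    refine ENNReal.ofReal_le_ofReal ?_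
    rw [intervalIntegral.integral_of_le Real.two_pi_pos.le,
      le_inv_mul_iff₀ Real.two_pi_pos] at hav
    simp only [Pi.neg_apply, integral_neg]
    linarith
  have hfatou : ∫⁻ θ in Ioc 0 (2 * Real.pi), liminf (fun n => L n θ) atTop ≠ ⊤ := by
    refine ne_top_of_le_ne_top (ENNReal.ofReal_ne_top (r := 2 * Real.pi * -C))
      ((lintegral_liminf_le hLm).trans ((liminf_le_liminf (Eventually.of_forall hLint)).trans ?_))
    rw [liminf_const]
  have hlt := ae_lt_top (.liminf hLm) hfatou
  have hpre : IsPreconnected unitDisk := unitDisk_eq_ball ▸ (convex_ball _ _).isPreconnected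
  filter_upwards [ae_restrict_of_ae_restrict_of_subset Ioo_subset_Ioc_self hlt,
    ae_restrict_of_ae (ae_forall_ne_zero isOpen_unitDisk hpre hf.1 hne)] with θ h1 h2 h3
  refine h1.ne (Tendsto.liminf_eq ?_)
  have h4 : Tendsto (fun n => f (ρ n * circlePt θ)) atTop (nhds 0) :=
    h3.comp (tendsto_nhdsWithin_iff.2 ⟨hρlim, Eventually.of_forall fun n => (hρ n).2⟩)
  have h5 : Tendsto (fun n => ‖f (ρ n * circlePt θ)‖) atTop (nhdsWithin 0 (Ioi 0)) :=
    tendsto_nhdsWithin_iff.2 ⟨by simpa using h4.norm, Eventually.of_forall fun n =>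
      norm_pos_iff.2 (h2 _ (hρ' n).1 (mul_circlePt_mem_unitDisk (hρ' n) θ))⟩
  exact ENNReal.tendsto_ofReal_atTop.comp
    (tendsto_neg_atBot_atTop.comp (Real.tendsto_log_nhdsGT_zero.comp h5))

open scoped ComplexConjugate

lemma isOpen_extDisk : IsOpen extDisk := isOpen_lt continuous_const continuous_norm

lemma isPreconnected_extDisk : IsPreconnected extDisk := by
  have h : extDisk = Complex.exp '' {z | 0 < z.re} := by
    ext z
    constructor
    · intro hz
      have hz0 : z ≠ 0 := by rintro rfl; simp [extDisk] at hz; linarith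
      refine ⟨Complex.log z, ?_, Complex.exp_log hz0⟩
      simpa [Complex.log_re] using Real.log_pos hz
    · rintro ⟨w, hw, rfl⟩
      simpa [extDisk, Complex.norm_exp] using hw
  rw [h]
  exact (convex_halfSpace_re_gt 0).isPreconnected.image _ Complex.continuous_exp.continuousOn

lemma mul_circlePt_mem_extDisk {r : ℝ} (hr : 1 < r) (θ : ℝ) : (r * circlePt θ : ℂ) ∈ extDisk := by
  simpa [extDisk, norm_circlePt, abs_of_pos (zero_lt_one.trans hr)] using hr

/-- Reflection of a function across the unit circle. -/
def circleReflect (f : ℂ → ℂ) (z : ℂ) : ℂ := conj (f (conj z⁻¹))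

lemma differentiableAt_circleReflect {f : ℂ → ℂ} {z : ℂ} (hz : z ≠ 0)
    (hf : DifferentiableAt ℂ f (conj z⁻¹)) : DifferentiableAt ℂ (circleReflect f) z := by
  have h : DifferentiableAt ℂ (conj ∘ f ∘ conj) z⁻¹ := by
    simpa using hf.conj_conj
  exact h.comp z (differentiableAt_inv hz)

lemma conj_inv_mul_circlePt (r θ : ℝ) :
    conj ((r : ℂ) * circlePt θ)⁻¹ = (r⁻¹ : ℝ) * circlePt θ := by
  have : conj (circlePt θ) = (circlePt θ)⁻¹ := by
    rw [circlePt, ← Complex.exp_neg, ← Complex.exp_conj]; simp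
  simp [this, mul_comm]

lemma SchurFn.differentiableOn_circleReflect {f : ℂ → ℂ} (hf : SchurFn f) :
    DifferentiableOn ℂ (circleReflect f) extDisk := by
  intro z hz
  have hz' : 1 < ‖z‖ := hz
  have hz0 : z ≠ 0 := norm_pos_iff.1 (zero_lt_one.trans hz')
  refine (differentiableAt_circleReflect hz0
    (hf.1.differentiableAt (isOpen_unitDisk.mem_nhds ?_))).differentiableWithinAt
  simpa [unitDisk] using inv_lt_one_of_one_lt₀ hz'

lemma SchurFn.norm_circleReflect_le {f : ℂ → ℂ} (hf : SchurFn f) {z : ℂ} (hz : z ∈ extDisk) :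
    ‖circleReflect f z‖ ≤ 1 := by
  rw [circleReflect, RCLike.norm_conj]
  exact hf.2 _ (by simpa [unitDisk] using inv_lt_one_of_one_lt₀ (show 1 < ‖z‖ from hz))

lemma RadLim.circleReflect {f : ℂ → ℂ} {θ : ℝ} {w : ℂ} (h : RadLim f θ w) :
    RadLimExt (circleReflect f) θ (conj w) := by
  have h1 : Tendsto (fun r : ℝ => r⁻¹) (nhdsWithin 1 (Ioi 1)) (nhdsWithin 1 (Iio 1)) := by
    refine tendsto_nhdsWithin_iff.2 ⟨?_, ?_⟩
    · have := (continuousAt_inv₀ (one_ne_zero (α := ℝ))).tendsto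
      rw [inv_one] at this
      exact this.mono_left nhdsWithin_le_nhds
    · filter_upwards [self_mem_nhdsWithin] with r hr using inv_lt_one_of_one_lt₀ (mem_Ioi.1 hr)
  refine ((Complex.continuous_conj.tendsto w).comp (h.comp h1)).congr fun r => ?_
  simp only [Function.comp_apply, _root_.circleReflect, conj_inv_mul_circlePt]

/-- Boundary uniqueness for bounded analytic functions in the exterior disk. -/
lemma ae_not_radLimExt_zero {N : ℂ → ℂ} (hN : DifferentiableOn ℂ N extDisk)
    (hb : ∀ z ∈ extDisk, ‖N z‖ ≤ 1) (hne : ∃ z ∈ extDisk, N z ≠ 0) :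
    ∀ᵐ θ ∂(volume.restrict (Ioo 0 (2 * Real.pi))), ¬ RadLimExt N θ 0 := by
  have hmem : ∀ z ∈ unitDisk, z ≠ 0 → conj z⁻¹ ∈ extDisk := fun z hz hz0 => by
    simpa [extDisk] using (one_lt_inv₀ (norm_pos_iff.2 hz0)).2 hz
  have hbd : ∀ z ∈ unitDisk, ‖z * circleReflect N z‖ ≤ ‖z‖ := by
    intro z hz
    rcases eq_or_ne z 0 with rfl | hz0
    · simp
    · rw [norm_mul, circleReflect, RCLike.norm_conj]
      exact mul_le_of_le_one_right (norm_nonneg _) (hb _ (hmem z hz hz0))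
  have hM : SchurFn fun z => z * circleReflect N z := by
    refine ⟨?_, fun z hz => (hbd z hz).trans (le_of_lt hz)⟩
    refine (Complex.differentiableOn_compl_singleton_and_continuousAt_iff
      (isOpen_unitDisk.mem_nhds (by simp [unitDisk] : (0 : ℂ) ∈ unitDisk))).1 ⟨?_, ?_⟩
    · intro z hz
      exact (differentiableAt_id.mul (differentiableAt_circleReflect hz.2
        (hN.differentiableAt (isOpen_extDisk.mem_nhds (hmem z hz.1 hz.2))))).differentiableWithinAt
    · rw [ContinuousAt, zero_mul]
      refine squeeze_zero_norm' ?_ (by simpa using (continuous_norm.tendsto (0 : ℂ)))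
      filter_upwards [isOpen_unitDisk.mem_nhds (by simp [unitDisk] : (0 : ℂ) ∈ unitDisk)]
        with z hz using hbd z hz
  have hMne : ∃ z ∈ unitDisk, z * circleReflect N z ≠ 0 := by
    obtain ⟨z, hz, hNz⟩ := hne
    have hz' : 1 < ‖z‖ := hz
    have hz0 : z ≠ 0 := norm_pos_iff.1 (zero_lt_one.trans hz')
    refine ⟨conj z⁻¹, by simpa [unitDisk] using inv_lt_one_of_one_lt₀ hz', ?_⟩
    simp [circleReflect, hz0, hNz]
  filter_upwards [hM.ae_not_radLim_zero hMne] with θ hθ h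
  refine hθ ?_
  have h1 : Tendsto (fun r : ℝ => r⁻¹) (nhdsWithin 1 (Iio 1)) (nhdsWithin 1 (Ioi 1)) := by
    refine tendsto_nhdsWithin_iff.2 ⟨?_, ?_⟩
    · have := (continuousAt_inv₀ (one_ne_zero (α := ℝ))).tendsto
      rw [inv_one] at this
      exact this.mono_left nhdsWithin_le_nhds
    · filter_upwards [eventually_mem_Ioo_half] with r hr
      exact (one_lt_inv₀ (by linarith [hr.1])).2 hr.2
  have h2 : Tendsto (fun r : ℝ => (r : ℂ) * circlePt θ) (nhdsWithin 1 (Iio 1))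
      (nhds ((1 : ℝ) * circlePt θ)) :=
    ((Complex.continuous_ofReal.tendsto 1).mono_left nhdsWithin_le_nhds).mul_const _
  have h3 := h2.mul ((Complex.continuous_conj.tendsto 0).comp (h.comp h1))
  rw [map_zero, mul_zero] at h3
  refine h3.congr fun r => ?_
  simp only [Function.comp_apply, circleReflect, conj_inv_mul_circlePt]

/-- The function on the circle with angular representative `ψ` on `(0, 2π]`. -/
def angleLift (ψ : ℝ → ℝ) (ζ : ℂ) : ℝ := ψ (toIocMod Real.two_pi_pos 0 ζ.arg)

lemma angleLift_circleMap (ψ : ℝ → ℝ) {t : ℝ} (ht : t ∈ Ioc 0 (2 * Real.pi)) :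
    angleLift ψ (circleMap 0 1 t) = ψ t := by
  rw [angleLift, ← circlePt_eq_circleMap, circlePt, Complex.arg_exp_mul_I, toIocMod_toIocMod,
    (toIocMod_eq_self _).2 (by simpa using ht)]

/-- The outer function with boundary modulus `exp (φ / 2)` on `γ` and `1` off `γ`. -/
def localOuter (γ : Set ℝ) (φ : ℝ → ℝ) (z : ℂ) : ℂ :=
  Complex.exp ((1 / 2 : ℂ) *
    ∫ θ in γ, ((circlePt θ + z) / (circlePt θ - z)) * (φ θ : ℂ) / (2 * Real.pi))

section LocalOuter

variable {γ : Set ℝ} {φ : ℝ → ℝ}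

lemma localOuter_eq (hγm : MeasurableSet γ) (hγ : γ ⊆ Ioc 0 (2 * Real.pi)) (z : ℂ) :
    localOuter γ φ z = Complex.exp ((1 / 2 : ℂ) * Real.circleAverage
      (fun ζ => herglotzRieszKernel 0 z ζ • (angleLift (γ.indicator φ) ζ : ℂ)) 0 1) := by
  rw [localOuter, Real.circleAverage_def, intervalIntegral.integral_of_le Real.two_pi_pos.le]
  congr 2
  rw [← integral_smul]
  trans ∫ θ in Ioc 0 (2 * Real.pi), γ.indicator
    (fun θ => ((circlePt θ + z) / (circlePt θ - z)) * (φ θ : ℂ) / (2 * Real.pi)) θ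
  · rw [setIntegral_indicator hγm, inter_eq_self_of_subset_right hγ]
  · refine setIntegral_congr_fun measurableSet_Ioc fun t ht => ?_
    simp only [angleLift_circleMap _ ht]
    simp only [herglotzRieszKernel, ← circlePt_eq_circleMap]
    by_cases h : t ∈ γ
    · simp [h]; ring
    · simp [h]

lemma intervalIntegrable_indicator (hγm : MeasurableSet γ) (hφ : IntegrableOn φ γ) :
    IntervalIntegrable (γ.indicator φ) volume 0 (2 * Real.pi) := by
  rw [intervalIntegrable_iff_integrableOn_Ioc_of_le Real.two_pi_pos.le]
  exact (integrable_indicator_iff hγm).2 hφ |>.integrableOn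

lemma circleIntegrable_angleLift (hγm : MeasurableSet γ)
    (hφ : IntegrableOn φ γ) : CircleIntegrable (angleLift (γ.indicator φ)) 0 1 := by
  have h := intervalIntegrable_indicator hγm hφ
  rw [CircleIntegrable, intervalIntegrable_iff_integrableOn_Ioc_of_le Real.two_pi_pos.le]
  rw [intervalIntegrable_iff_integrableOn_Ioc_of_le Real.two_pi_pos.le] at h
  refine h.congr_fun (fun t ht => ?_) measurableSet_Ioc
  exact (angleLift_circleMap _ ht).symm

lemma norm_localOuter (hγm : MeasurableSet γ) (hγ : γ ⊆ Ioc 0 (2 * Real.pi))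
    (hφ : IntegrableOn φ γ) {z : ℂ} (hz : z ∈ unitDisk) :
    ‖localOuter γ φ z‖ = Real.exp (1 / 2 * ((2 * Real.pi)⁻¹ *
      ∫ t in 0..2 * Real.pi, poissonKernel 0 z (circleMap 0 1 t) * γ.indicator φ t)) := by
  rw [localOuter_eq hγm hγ, Complex.norm_exp]
  have h : ((1 / 2 : ℂ) * Real.circleAverage (fun ζ => herglotzRieszKernel 0 z ζ •
      (angleLift (γ.indicator φ) ζ : ℂ)) 0 1).re = 1 / 2 * (Real.circleAverage
        (fun ζ => herglotzRieszKernel 0 z ζ • (angleLift (γ.indicator φ) ζ : ℂ)) 0 1).re := by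
    rw [Complex.mul_re]; simp
  rw [h, re_circleAverage_herglotzRieszKernel_smul (circleIntegrable_angleLift hγm hφ)
    (unitDisk_eq_ball ▸ hz), ← poissonKernel_eq_re_herglotzRieszKernel, Real.circleAverage_def,
    smul_eq_mul]
  congr 3
  refine intervalIntegral.integral_congr_ae (ae_of_all _ fun t ht => ?_)
  rw [uIoc_of_le Real.two_pi_pos.le] at ht
  simp [angleLift_circleMap _ ht]

lemma schurFn_localOuter (hγm : MeasurableSet γ) (hγ : γ ⊆ Ioc 0 (2 * Real.pi))
    (hφ : IntegrableOn φ γ) (hφ0 : ∀ᵐ θ ∂(volume.restrict γ), φ θ ≤ 0) :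
    SchurFn (localOuter γ φ) := by
  constructor
  · have h : CircleIntegrable (fun ζ => (angleLift (γ.indicator φ) ζ : ℂ)) 0 1 := by
      have := circleIntegrable_angleLift hγm hφ
      simp only [CircleIntegrable, intervalIntegrable_iff] at this ⊢
      exact Complex.ofRealCLM.integrable_comp this
    rw [unitDisk_eq_ball]
    refine ((differentiableOn_circleAverage_herglotzRieszKernel_smul h).const_mul
      (1 / 2 : ℂ)).cexp.congr fun z _ => localOuter_eq hγm hγ z
  · intro z hz
    rw [norm_localOuter hγm hγ hφ hz, Real.exp_le_one_iff]
    refine mul_nonpos_of_nonneg_of_nonpos (by norm_num)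
      (mul_nonpos_of_nonneg_of_nonpos (by positivity) ?_)
    rw [intervalIntegral.integral_of_le Real.two_pi_pos.le]
    refine integral_nonpos_of_ae (ae_restrict_of_ae ?_)
    filter_upwards [(ae_restrict_iff' hγm).1 hφ0] with t ht
    refine mul_nonpos_of_nonneg_of_nonpos ?_ (indicator_apply_nonpos ht)
    rw [poissonKernel, sub_zero, sub_zero, ← circlePt_eq_circleMap, norm_circlePt]
    have : ‖z‖ < 1 := hz
    exact div_nonneg (by nlinarith [norm_nonneg z]) (by positivity)

/-- The local outer function has radial limits of the prescribed modulus a.e. on `γ`. -/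
lemma ae_radLim_localOuter (hγm : MeasurableSet γ) (hγ : γ ⊆ Ioo 0 (2 * Real.pi))
    (hφ : IntegrableOn φ γ) (hφ0 : ∀ᵐ θ ∂(volume.restrict γ), φ θ ≤ 0) :
    ∀ᵐ θ ∂(volume.restrict γ), ∃ w, RadLim (localOuter γ φ) θ w ∧ ‖w‖ ^ 2 = Real.exp (φ θ) := by
  have hγ' := hγ.trans Ioo_subset_Ioc_self
  filter_upwards [ae_restrict_of_ae_restrict_of_subset hγ
      (schurFn_localOuter hγm hγ' hφ hφ0).ae_exists_radLim,
    ae_restrict_of_ae_restrict_of_subset hγ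
      (ae_tendsto_integral_diskPoisson (intervalIntegrable_indicator hγm hφ)),
    ae_restrict_mem hγm] with θ ⟨w, hw⟩ hP hθ
  refine ⟨w, hw, ?_⟩
  have h1 : Tendsto (fun r : ℝ => ‖localOuter γ φ (r * circlePt θ)‖) (nhdsWithin 1 (Iio 1))
      (nhds (Real.exp (1 / 2 * ((2 * Real.pi)⁻¹ * (2 * Real.pi * γ.indicator φ θ))))) := by
    refine ((Real.continuous_exp.tendsto _).comp
      ((hP.const_mul (2 * Real.pi)⁻¹).const_mul (1 / 2))).congr' ?_
    filter_upwards [eventually_mem_Ioo_half] with r hr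
    rw [norm_localOuter hγm hγ' hφ (mul_circlePt_mem_unitDisk ⟨by linarith [hr.1], hr.2⟩ θ)]
    simp only [Function.comp_apply, diskPoisson_eq_poissonKernel]
  rw [tendsto_nhds_unique hw.norm h1, ← Real.exp_nat_mul, indicator_of_mem hθ]
  congr 1
  have := Real.pi_pos
  push_cast
  field_simp

end LocalOuter

lemma SchurFn.norm_le_of_radLim {f : ℂ → ℂ} (hf : SchurFn f) {θ : ℝ} {w : ℂ}
    (h : RadLim f θ w) : ‖w‖ ≤ 1 := by
  refine le_of_tendsto h.norm ?_
  filter_upwards [eventually_mem_Ioo_half] with r hr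
  exact hf.2 _ (mul_circlePt_mem_unitDisk ⟨by linarith [hr.1], hr.2⟩ θ)

lemma pcArc_of_forall_eq_zero {f : ℂ → ℂ} (hf : ∀ z ∈ unitDisk, f z = 0) (γ : Set ℝ) :
    PCArc f γ := by
  refine ⟨0, ⟨0, 1, by fun_prop, by fun_prop, by simp, by simp, ⟨2, by simp [extDisk], by simp⟩,
    by simp⟩, ae_of_all _ fun θ => ⟨0, tendsto_const_nhds.congr' ?_, tendsto_const_nhds⟩⟩
  filter_upwards [eventually_mem_Ioo_half] with r hr
  exact (hf _ (mul_circlePt_mem_unitDisk ⟨by linarith [hr.1], hr.2⟩ θ)).symm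

lemma SchurFn.exists_circleReflect_ne_zero {f : ℂ → ℂ} (hf : SchurFn f)
    (hne : ∃ z ∈ unitDisk, f z ≠ 0) : ∃ z ∈ extDisk, circleReflect f z ≠ 0 := by
  have hpre : IsPreconnected unitDisk := unitDisk_eq_ball ▸ (convex_ball _ _).isPreconnected
  obtain ⟨θ, hθ⟩ := (ae_forall_ne_zero isOpen_unitDisk hpre hf.1 hne).exists
  refine ⟨(2 : ℝ) * circlePt θ, mul_circlePt_mem_extDisk (by norm_num) θ, ?_⟩
  have := hθ 2⁻¹ (by norm_num) (mul_circlePt_mem_unitDisk (by norm_num) θ)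
  rw [circleReflect, conj_inv_mul_circlePt]
  simpa using this

/-- If `f` has a pseudocontinuation of bounded type across `γ`, then `1 - ‖f‖ ^ 2` on `γ` is the
boundary function of some `q = 2 N / D` in the exterior disk, with `N` and `D` contractive. -/
lemma PCArc.exists_defect {f : ℂ → ℂ} {fb : ℝ → ℂ} {γ : Set ℝ} (hf : SchurFn f)
    (hb : ∀ᵐ θ ∂(volume.restrict γ), RadLim f θ (fb θ)) (hpc : PCArc f γ) :
    ∃ N D q : ℂ → ℂ, DifferentiableOn ℂ N extDisk ∧ DifferentiableOn ℂ D extDisk ∧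
      (∀ z ∈ extDisk, ‖N z‖ ≤ 1) ∧ (∀ z ∈ extDisk, ‖D z‖ ≤ 1) ∧ (∃ z ∈ extDisk, D z ≠ 0) ∧
      (∀ z ∈ extDisk, D z ≠ 0 → 2 * N z = D z * q z) ∧
      ∀ᵐ θ ∂(volume.restrict γ), RadLimExt q θ (1 - (‖fb θ‖ : ℂ) ^ 2) := by
  obtain ⟨ft, ⟨f₁, f₂, hd₁, hd₂, hb₁, hb₂, hne, hft⟩, hlim⟩ := hpc
  refine ⟨fun z => (f₂ z - f₁ z * circleReflect f z) / 2, f₂,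
    fun z => 1 - ft z * circleReflect f z,
    (hd₂.sub (hd₁.mul hf.differentiableOn_circleReflect)).div_const 2, hd₂, fun z hz => ?_, hb₂,
    hne, fun z hz h2 => ?_, ?_⟩
  · have h1 : ‖f₁ z * circleReflect f z‖ ≤ 1 := by
      rw [norm_mul]
      exact mul_le_one₀ (hb₁ z hz) (norm_nonneg _) (hf.norm_circleReflect_le hz)
    rw [norm_div, Complex.norm_ofNat, div_le_one two_pos]
    linarith [norm_sub_le (f₂ z) (f₁ z * circleReflect f z), hb₂ z hz]
  · simp only [hft z hz h2]
    field_simp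
  · filter_upwards [hb, hlim] with θ h1 ⟨w, h2, h3⟩
    obtain rfl := tendsto_nhds_unique h1 h2
    rw [← Complex.mul_conj']
    exact (h3.mul h1.circleReflect).const_sub 1

/-- The boundary modulus of a pseudocontinuable Schur function is either almost everywhere or
almost nowhere equal to `1`. -/
lemma PCArc.norm_ae_ne_one_or_ae_eq_one {f : ℂ → ℂ} {fb : ℝ → ℂ} {γ : Set ℝ} (hf : SchurFn f)
    (hγ : γ ⊆ Ioo 0 (2 * Real.pi))
    (hb : ∀ᵐ θ ∂(volume.restrict γ), RadLim f θ (fb θ)) (hpc : PCArc f γ) :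
    (∀ᵐ θ ∂(volume.restrict γ), ‖fb θ‖ ≠ 1) ∨ ∀ᵐ θ ∂(volume.restrict γ), ‖fb θ‖ = 1 := by
  obtain ⟨N, D, q, hN, hD, hNb, hDb, hDne, hNq, hq⟩ := hpc.exists_defect hf hb
  have hDae := ae_restrict_of_ae (s := γ)
    (ae_forall_ne_zero isOpen_extDisk isPreconnected_extDisk hD hDne)
  by_cases hN0 : ∃ z ∈ extDisk, N z ≠ 0
  · left
    filter_upwards [hDae, hq, ae_restrict_of_ae_restrict_of_subset hγ
      (ae_not_radLimExt_zero hN hNb hN0)] with θ hD0 hqθ hNθ h1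
    rw [h1, Complex.ofReal_one, one_pow, sub_self] at hqθ
    refine hNθ (squeeze_zero_norm' ?_ (by simpa using Tendsto.norm hqθ))
    filter_upwards [self_mem_nhdsWithin] with r hr
    have hmem := mul_circlePt_mem_extDisk (mem_Ioi.1 hr) θ
    have h2 := congrArg norm (hNq _ hmem (hD0 r (zero_lt_one.trans hr) hmem))
    rw [norm_mul, norm_mul, Complex.norm_ofNat] at h2
    nlinarith [hDb _ hmem, norm_nonneg (q (r * circlePt θ)), norm_nonneg (N (r * circlePt θ)),
      mul_le_mul_of_nonneg_right (hDb _ hmem) (norm_nonneg (q (r * circlePt θ)))]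
  · right
    push Not at hN0
    filter_upwards [hDae, hq] with θ hD0 hqθ
    have h0 : RadLimExt q θ 0 := by
      refine tendsto_const_nhds.congr' ?_
      filter_upwards [self_mem_nhdsWithin] with r hr
      have hmem := mul_circlePt_mem_extDisk (mem_Ioi.1 hr) θ
      have hDr := hD0 r (zero_lt_one.trans hr) hmem
      have h2 := hNq _ hmem hDr
      rw [hN0 _ hmem, mul_zero] at h2
      exact ((mul_eq_zero.1 h2.symm).resolve_left hDr).symm
    have h3 : (‖fb θ‖ : ℂ) ^ 2 = 1 := (sub_eq_zero.1 (tendsto_nhds_unique hqθ h0)).symm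
    have h4 : ‖fb θ‖ ^ 2 = 1 := by exact_mod_cast h3
    exact (pow_eq_one_iff_of_nonneg (norm_nonneg _) two_ne_zero).1 h4

/-- Pseudocontinuability passes between Schur functions with complementary boundary moduli. -/
lemma PCArc.of_complementary {f g : ℂ → ℂ} {fb gb : ℝ → ℂ} {γ : Set ℝ} (hf : SchurFn f)
    (hg : SchurFn g) (hγ : γ ⊆ Ioo 0 (2 * Real.pi))
    (hfb : ∀ᵐ θ ∂(volume.restrict γ), RadLim f θ (fb θ))
    (hgb : ∀ᵐ θ ∂(volume.restrict γ), RadLim g θ (gb θ))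
    (hfg : ∀ᵐ θ ∂(volume.restrict γ), ‖fb θ‖ ^ 2 + ‖gb θ‖ ^ 2 = 1) (hpc : PCArc f γ) :
    PCArc g γ := by
  by_cases hg0 : ∃ z ∈ unitDisk, g z ≠ 0
  swap
  · push Not at hg0
    exact pcArc_of_forall_eq_zero hg0 γ
  obtain ⟨N, D, q, hN, hD, hNb, hDb, hDne, hNq, hq⟩ := hpc.exists_defect hf hfb
  refine ⟨fun z => q z / circleReflect g z, ⟨N, fun z => D z * circleReflect g z / 2, hN,
    (hD.mul hg.differentiableOn_circleReflect).div_const 2, hNb, fun z hz => ?_, ?_,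
    fun z hz h => ?_⟩, ?_⟩
  · rw [norm_div, norm_mul, Complex.norm_ofNat]
    linarith [mul_le_one₀ (hDb z hz) (norm_nonneg _) (hg.norm_circleReflect_le hz)]
  · obtain ⟨θ, h1, h2⟩ := ((ae_forall_ne_zero isOpen_extDisk isPreconnected_extDisk hD hDne).and
      (ae_forall_ne_zero isOpen_extDisk isPreconnected_extDisk hg.differentiableOn_circleReflect
        (hg.exists_circleReflect_ne_zero hg0))).exists
    have hmem := mul_circlePt_mem_extDisk one_lt_two θ
    exact ⟨_, hmem, div_ne_zero (mul_ne_zero (h1 2 two_pos hmem) (h2 2 two_pos hmem)) two_ne_zero⟩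
  · have hD0 : D z ≠ 0 := fun h0 => h (by simp [h0])
    have hg0 : circleReflect g z ≠ 0 := fun h0 => h (by simp [h0])
    have := hNq z hz hD0
    field_simp
    linear_combination -this
  · filter_upwards [hgb, hfg, hq, ae_restrict_of_ae_restrict_of_subset hγ
      (hg.ae_not_radLim_zero hg0)] with θ h1 h2 h3 h4
    have hgb0 : gb θ ≠ 0 := fun h => h4 (h ▸ h1)
    have hgb0' : conj (gb θ) ≠ 0 := by simpa using hgb0
    have h5 : (1 - (‖fb θ‖ : ℂ) ^ 2) = gb θ * conj (gb θ) := by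
      rw [Complex.mul_conj', sub_eq_iff_eq_add']
      exact_mod_cast h2.symm
    refine ⟨gb θ, h1, ?_⟩
    have := Tendsto.div h3 h1.circleReflect hgb0'
    rw [h5, mul_div_cancel_right₀ _ hgb0'] at this
    exact this

/-- A Schur function with unimodular boundary values on `γ` is pseudocontinuable across `γ`. -/
lemma pcArc_of_ae_norm_eq_one {g : ℂ → ℂ} {gb : ℝ → ℂ} {γ : Set ℝ} (hg : SchurFn g)
    (hγ : γ ⊆ Ioo 0 (2 * Real.pi)) (hgb : ∀ᵐ θ ∂(volume.restrict γ), RadLim g θ (gb θ))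
    (h1 : ∀ᵐ θ ∂(volume.restrict γ), ‖gb θ‖ = 1) : PCArc g γ :=
  PCArc.of_complementary (f := 0) (fb := 0) ⟨by fun_prop, by simp⟩ hg hγ
    (ae_of_all _ fun _ => tendsto_const_nhds) hgb (h1.mono fun θ h => by simp [h])
    (pcArc_of_forall_eq_zero (by simp) γ)

/-- Proposition 2: for a Schur function `s` with `log(1-|s|²) ∈ L¹(γ)`,
`s` admits a pseudocontinuation of bounded type across `γ` iff the local outer factor
`σ_γ` does. -/
theorem statement13 (s : ℂ → ℂ) (sb : ℝ → ℂ) (γ : Set ℝ) (hγ : IsArc γ)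
    (hs : SchurFn s)
    (hb : ∀ᵐ θ ∂(volume.restrict γ), RadLim s θ (sb θ))
    (hint : IntegrableOn (fun θ => Real.log (1 - ‖sb θ‖ ^ 2)) γ) :
    PCArc s γ ↔
      PCArc (fun z => Complex.exp ((1 / 2 : ℂ) *
        ∫ θ in γ, ((circlePt θ + z) / (circlePt θ - z)) *
          (Real.log (1 - ‖sb θ‖ ^ 2) : ℂ) / (2 * Real.pi))) γ := by
  change PCArc s γ ↔ PCArc (localOuter γ fun θ => Real.log (1 - ‖sb θ‖ ^ 2)) γ
  have hγm : MeasurableSet γ := by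
    obtain ⟨a, b, -, -, -, rfl⟩ := hγ
    exact measurableSet_Ioo
  have hγ' : γ ⊆ Ioo 0 (2 * Real.pi) := by
    obtain ⟨a, b, ha, -, hb', rfl⟩ := hγ
    exact Ioo_subset_Ioo ha hb'
  have hle : ∀ᵐ θ ∂(volume.restrict γ), ‖sb θ‖ ≤ 1 := hb.mono fun θ h => hs.norm_le_of_radLim h
  have hφ0 : ∀ᵐ θ ∂(volume.restrict γ), Real.log (1 - ‖sb θ‖ ^ 2) ≤ 0 := hle.mono fun θ h =>
    Real.log_nonpos (by nlinarith [norm_nonneg (sb θ)]) (by nlinarith [norm_nonneg (sb θ)])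
  have hσ := schurFn_localOuter hγm (hγ'.trans Ioo_subset_Ioc_self) hint hφ0
  obtain ⟨σb, hσb⟩ : ∃ σb : ℝ → ℂ, ∀ᵐ θ ∂(volume.restrict γ),
      RadLim (localOuter γ fun θ => Real.log (1 - ‖sb θ‖ ^ 2)) θ (σb θ) ∧
        ‖σb θ‖ ^ 2 = Real.exp (Real.log (1 - ‖sb θ‖ ^ 2)) :=
    ⟨fun θ => Classical.epsilon fun w =>
        RadLim (localOuter γ fun θ => Real.log (1 - ‖sb θ‖ ^ 2)) θ w ∧
          ‖w‖ ^ 2 = Real.exp (Real.log (1 - ‖sb θ‖ ^ 2)),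
      (ae_radLim_localOuter hγm hγ' hint hφ0).mono fun θ h => Classical.epsilon_spec h⟩
  have hlim := hσb.mono fun θ h => h.1
  have hcompl : ∀ᵐ θ ∂(volume.restrict γ), ‖sb θ‖ ≠ 1 → ‖sb θ‖ ^ 2 + ‖σb θ‖ ^ 2 = 1 := by
    filter_upwards [hle, hσb] with θ h1 h2 h3
    have h4 : ‖sb θ‖ < 1 := lt_of_le_of_ne h1 h3
    rw [h2.2, Real.exp_log (by nlinarith [norm_nonneg (sb θ)])]
    ring
  have hone : ∀ᵐ θ ∂(volume.restrict γ), ‖sb θ‖ = 1 → ‖σb θ‖ = 1 := by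
    filter_upwards [hσb] with θ h2 h3
    have h4 := h2.2
    rw [h3, one_pow, sub_self, Real.log_zero, Real.exp_zero] at h4
    exact (pow_eq_one_iff_of_nonneg (norm_nonneg _) two_ne_zero).1 h4
  constructor
  · intro h
    rcases h.norm_ae_ne_one_or_ae_eq_one hs hγ' hb with hne | heq
    · exact h.of_complementary hs hσ hγ' hb hlim (hcompl.mp (hne.mono fun θ h1 h2 => h2 h1))
    · exact pcArc_of_ae_norm_eq_one hσ hγ' hlim (hone.mp (heq.mono fun θ h1 h2 => h2 h1))
  · intro h
    rcases h.norm_ae_ne_one_or_ae_eq_one hσ hγ' hlim with hne | heq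
    · refine h.of_complementary hσ hs hγ' hlim hb ?_
      filter_upwards [hne, hone, hcompl] with θ h1 h2 h3
      rw [add_comm]
      exact h3 fun h4 => h1 (h2 h4)
    · by_cases hs0 : ∃ z ∈ unitDisk, s z ≠ 0
      · refine pcArc_of_ae_norm_eq_one hs hγ' hb ?_
        filter_upwards [hb, heq, hcompl, ae_restrict_of_ae_restrict_of_subset hγ'
          (hs.ae_not_radLim_zero hs0)] with θ h1 h2 h3 h4
        by_contra h5
        have h6 := h3 h5
        rw [h2, one_pow, add_eq_right, sq_eq_zero_iff, norm_eq_zero] at h6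
        exact h4 (h6 ▸ h1)
      · push Not at hs0
        exact pcArc_of_forall_eq_zero hs0 γ
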